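/- If the switching interaction graph G_{σ(t)} is uniformly jointly L-connected (UJLC), then the system is SiISS with respect to ℒ(y(t)); moreover the gain can be taken as γ(s) = (4n+1)√2 s. -/

import Mathlib

open Metric Set Filter MeasureTheory

noncomputable section

/-- Data of the multi-agent system (5): the switching communication topology
(neighbor sets `Nb`, leader sets `Ld`), the weight functions `A` (= `a_{ij}`),
`B` (= `b_{ij}`), the dwell time `τD` and the weight bounds `aLo = a_*`,
`aHi = a^*`, `bLo = b_*`, together with Assumptions 1 and 2. -/
structure MASData (d n k : ℕ) where
  hn : 2 ≤ n
  hk : 1 ≤ k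
  Nb : ℝ → Fin n → Finset (Fin n)
  Ld : ℝ → Fin n → Finset (Fin k)
  A : Fin n → Fin n → (Fin n → EuclideanSpace ℝ (Fin d)) →
    (Fin k → EuclideanSpace ℝ (Fin d)) → ℝ → ℝ
  B : Fin n → Fin k → (Fin n → EuclideanSpace ℝ (Fin d)) →
    (Fin k → EuclideanSpace ℝ (Fin d)) → ℝ → ℝ
  τD : ℝ
  aLo : ℝ
  aHi : ℝ
  bLo : ℝ
  τD_pos : 0 < τD
  aLo_pos : 0 < aLo
  bLo_pos : 0 < bLo
  A_bdd : ∀ i j xv yv t, aLo ≤ A i j xv yv t ∧ A i j xv yv t ≤ aHi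
  B_bdd : ∀ i j xv yv t, bLo ≤ B i j xv yv t
  A_cont : ∀ i j, Continuous fun p :
    (Fin n → EuclideanSpace ℝ (Fin d)) × (Fin k → EuclideanSpace ℝ (Fin d)) × ℝ =>
    A i j p.1 p.2.1 p.2.2
  B_cont : ∀ i j, Continuous fun p :
    (Fin n → EuclideanSpace ℝ (Fin d)) × (Fin k → EuclideanSpace ℝ (Fin d)) × ℝ =>
    B i j p.1 p.2.1 p.2.2
  /-- The topology is piecewise constant with consecutive switching instants
  separated by at least the dwell time `τD` (Assumption 1). -/
  dwell : ∃ s : ℕ → ℝ, s 0 = 0 ∧ (∀ m : ℕ, s m + τD ≤ s (m + 1)) ∧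
    ∀ m : ℕ, ∀ t₁ ∈ Set.Ico (s m) (s (m + 1)), ∀ t₂ ∈ Set.Ico (s m) (s (m + 1)),
      Nb t₁ = Nb t₂ ∧ Ld t₁ = Ld t₂

namespace MASData

variable {d n k : ℕ}

/-- The arc relation of the communication graph at time `t`, on the node set
`Fin k ⊕ Fin n` (leaders ⊕ followers).  `arcAt t v v'` means there is an arc
leaving `v` and entering `v'`; there are no arcs from followers into leaders. -/
def arcAt (D : MASData d n k) (t : ℝ) (v v' : Fin k ⊕ Fin n) : Prop :=
  match v, v' with
  | Sum.inl j, Sum.inr i => j ∈ D.Ld t i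
  | Sum.inr j, Sum.inr i => j ∈ D.Nb t i
  | _, _ => False

/-- Arc relation of the union graph over the set of times `T`. -/
def arcOn (D : MASData d n k) (T : Set ℝ) (v v' : Fin k ⊕ Fin n) : Prop :=
  ∃ t ∈ T, D.arcAt t v v'

/-- The union graph over the set of times `T` is L-connected: every follower is
reachable from some leader by a directed path. -/
def LConnectedOn (D : MASData d n k) (T : Set ℝ) : Prop :=
  ∀ i : Fin n, ∃ j : Fin k, Relation.ReflTransGen (D.arcOn T) (Sum.inl j) (Sum.inr i)

/-- Uniformly jointly L-connected. -/
def UJLC (D : MASData d n k) : Prop :=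
  ∃ T > (0:ℝ), ∀ t ≥ (0:ℝ), D.LConnectedOn (Set.Ico t (t + T))

/-- Jointly L-connected. -/
def JLC (D : MASData d n k) : Prop :=
  ∀ t ≥ (0:ℝ), D.LConnectedOn (Set.Ici t)

end MASData

/-- A solution (trajectory) of system (5) together with its inputs: leader
controls `u`, disturbances `w`, follower states `x` and leader states `y`;
the dynamics hold in the sense of right derivatives for `t ≥ 0`, and the
(piecewise continuous) inputs are locally interval integrable along the
solution. -/
structure MASSol {d n k : ℕ} (D : MASData d n k) where
  x : ℝ → Fin n → EuclideanSpace ℝ (Fin d)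
  y : ℝ → Fin k → EuclideanSpace ℝ (Fin d)
  u : Fin k → (Fin k → EuclideanSpace ℝ (Fin d)) → ℝ → EuclideanSpace ℝ (Fin d)
  w : Fin n → ℝ → EuclideanSpace ℝ (Fin d)
  u_cont : ∀ j t, Continuous fun yv => u j yv t
  w_cont : ∀ i, Continuous (w i)
  x_cont : ∀ i, Continuous fun t => x t i
  y_cont : ∀ j, Continuous fun t => y t j
  dyn_y : ∀ (j : Fin k), ∀ t ≥ (0:ℝ),
    HasDerivWithinAt (fun s => y s j) (u j (y t) t) (Set.Ici t) t
  dyn_x : ∀ (i : Fin n), ∀ t ≥ (0:ℝ),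
    HasDerivWithinAt (fun s => x s i)
      ((∑ j ∈ D.Nb t i, D.A i j (x t) (y t) t • (x t j - x t i)) +
        (∑ j ∈ D.Ld t i, D.B i j (x t) (y t) t • (y t j - x t i)) + w i t)
      (Set.Ici t) t
  r_int : ∀ a b : ℝ, IntervalIntegrable (fun t => ⨆ j : Fin k, ‖u j (y t) t‖)
    MeasureTheory.volume a b
  q_int : ∀ a b : ℝ, IntervalIntegrable
    (fun t => (⨆ j : Fin k, ‖u j (y t) t‖) + ⨆ i : Fin n, ‖w i t‖)
    MeasureTheory.volume a b
  z_int : ∀ a b : ℝ, IntervalIntegrable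
    (fun t => Real.sqrt ((∑ j : Fin k, ‖u j (y t) t‖ ^ 2) + ∑ i : Fin n, ‖w i t‖ ^ 2))
    MeasureTheory.volume a b

namespace MASSol

variable {d n k : ℕ} {D : MASData d n k}

/-- The moving multi-leader set `ℒ(y(t))`: the convex hull of the leaders. -/
def Lset (sol : MASSol D) (t : ℝ) : Set (EuclideanSpace ℝ (Fin d)) :=
  convexHull ℝ (Set.range (sol.y t))

/-- `|x(t)|_{ℒ(y(t))}`: the maximal distance of the followers from `ℒ(y(t))`. -/
def distL (sol : MASSol D) (t : ℝ) : ℝ :=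
  ⨆ i : Fin n, Metric.infDist (sol.x t i) (sol.Lset t)

/-- `r(t) = max_j |u_j(y(t),t)|`. -/
def rmax (sol : MASSol D) (t : ℝ) : ℝ := ⨆ j : Fin k, ‖sol.u j (sol.y t) t‖

/-- `q(t) = max_j |u_j(y(t),t)| + max_i |w_i(t)|`. -/
def qmax (sol : MASSol D) (t : ℝ) : ℝ := sol.rmax t + ⨆ i : Fin n, ‖sol.w i t‖

/-- `|z(t)|`: the Euclidean norm of the combined input `z = (u, w)` at time `t`. -/
def znorm (sol : MASSol D) (t : ℝ) : ℝ :=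
  Real.sqrt ((∑ j : Fin k, ‖sol.u j (sol.y t) t‖ ^ 2) + ∑ i : Fin n, ‖sol.w i t‖ ^ 2)

/-- `‖z‖_∞ = sup_{t ≥ 0} |z(t)|`. -/
def zsup (sol : MASSol D) : ℝ := sSup (sol.znorm '' Set.Ici 0)

/-- The combined input `z` is (essentially) bounded, i.e. `z ∈ L_∞`. -/
def zBounded (sol : MASSol D) : Prop := BddAbove (sol.znorm '' Set.Ici 0)

end MASSol

/-- Class-𝒦 function on `[0,∞)`. -/
def IsClassK (γ : ℝ → ℝ) : Prop :=
  ContinuousOn γ (Set.Ici 0) ∧ StrictMonoOn γ (Set.Ici 0) ∧ γ 0 = 0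

/-- Class-𝒦𝓛 function. -/
def IsClassKL (β : ℝ → ℝ → ℝ) : Prop :=
  (∀ t ≥ (0:ℝ), IsClassK fun s => β s t) ∧
  (∀ s ≥ (0:ℝ), AntitoneOn (fun t => β s t) (Set.Ici 0) ∧
    Filter.Tendsto (fun t => β s t) Filter.atTop (nhds 0))

/-- System (5) is (generalized) set input-to-state stable with respect to
`ℒ(y(t))` with input `z`. -/
def MASData.SISS {d n k : ℕ} (D : MASData d n k) : Prop :=
  ∃ β γ, IsClassKL β ∧ IsClassK γ ∧
    ∀ sol : MASSol D, sol.zBounded →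
      ∀ t ≥ (0:ℝ), sol.distL t ≤ β (sol.distL 0) t + γ sol.zsup

/-- System (5) is (generalized) set integral-input-to-state stable with respect
to `ℒ(y(t))`. -/
def MASData.SiISS {d n k : ℕ} (D : MASData d n k) : Prop :=
  ∃ β γ, IsClassKL β ∧ IsClassK γ ∧
    ∀ sol : MASSol D, ∀ t ≥ (0:ℝ),
      sol.distL t ≤ β (sol.distL 0) t + ∫ s in (0:ℝ)..t, γ (sol.znorm s)

/-- The upper Dini derivative `D⁺h(t) = limsup_{s→0⁺} (h(t+s) − h(t))/s`. -/
def upperDini (h : ℝ → ℝ) (t : ℝ) : ℝ :=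
  Filter.limsup (fun s => (h (t + s) - h t) / s) (nhdsWithin 0 (Set.Ioi 0))

/-- Scalar functions `h i` on `[0, S]` with right derivatives `h' i`, driven by a consensus
protocol with weights `α` among the `h i` and an attraction of strength `b` towards `0`. -/
structure ConsensusInequality {ι : Type*} [Fintype ι] (S aHi : ℝ) (α : ℝ → ι → ι → ℝ)
    (b : ℝ → ι → ℝ) (h h' : ι → ℝ → ℝ) : Prop where
  cont : ∀ i, Continuous (h i)
  deriv : ∀ i, ∀ t ∈ Ico 0 S, HasDerivWithinAt (h i) (h' i t) (Ici t) t
  le : ∀ i, ∀ t ∈ Ico 0 S, h' i t ≤ ∑ j, α t i j * (h j t - h i t) - b t i * h i t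
  α_nonneg : ∀ t i j, 0 ≤ α t i j
  α_le : ∀ t i j, α t i j ≤ aHi
  b_nonneg : ∀ t i, 0 ≤ b t i

/-- In every time window of length `T`, any set of indices that is not everything is entered, from
inside or from the origin, by an arc that persists for a time `θ`. -/
def PersistentlyEntering {ι : Type*} [Fintype ι] (θ T aLo bLo : ℝ) (α : ℝ → ι → ι → ℝ)
    (b : ℝ → ι → ℝ) : Prop :=
  ∀ t ≥ (0 : ℝ), ∀ A : Finset ι, A ≠ Finset.univ → ∃ i ∉ A, ∃ p, t ≤ p ∧ p + θ ≤ t + T ∧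
    ((∀ s ∈ Ico p (p + θ), bLo ≤ b s i) ∨ ∃ j ∈ A, ∀ s ∈ Ico p (p + θ), aLo ≤ α s i j)

namespace ConsensusInequality

variable {ι : Type*} [Fintype ι] {S aHi : ℝ} {α : ℝ → ι → ι → ℝ} {b : ℝ → ι → ℝ}
  {h h' : ι → ℝ → ℝ}

theorem le_add_mul (H : ConsensusInequality S aHi α b h h') {t₀ M ε : ℝ} (ht₀ : 0 ≤ t₀)
    (hM : 0 ≤ M) (hε : 0 < ε) (h₀ : ∀ i, h i t₀ ≤ M) {t : ℝ} (ht : t ∈ Icc t₀ S) (i : ι) :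
    h i t ≤ M + ε * (1 + (t - t₀)) := by
  have hcont := H.cont
  suffices hs : Icc t₀ S ⊆ {t | ∀ i, h i t ≤ M + ε * (1 + (t - t₀))} from hs ht i
  apply IsClosed.Icc_subset_of_forall_exists_gt
  · refine IsClosed.inter ?_ isClosed_Icc
    simp only [ofPred_forall]
    exact isClosed_iInter fun i => isClosed_le (hcont i) (by fun_prop)
  · intro i
    simp only [sub_self]
    linarith [h₀ i]
  · rintro x ⟨hxs, hx⟩ y hy
    have hev : ∀ i, ∀ᶠ z in nhdsWithin x (Ioi x), h i z ≤ M + ε * (1 + (z - t₀)) := by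
      intro i
      rcases (hxs i).lt_or_eq with hlt | heq
      · have hc : Continuous fun z => M + ε * (1 + (z - t₀)) := by fun_prop
        have := ((hcont i).tendsto x).eventually_lt (hc.tendsto x) hlt
        filter_upwards [nhdsWithin_le_nhds this] with z hz using hz.le
      · have hpos : 0 < h i x := by
          rw [heq]
          have : 0 ≤ x - t₀ := by linarith [hx.1]
          positivity
        have hneg : h' i x < ε := by
          refine ((H.le i x ⟨ht₀.trans hx.1, hx.2⟩).trans ?_).trans_lt hε
          have h1 : ∑ j, α x i j * (h j x - h i x) ≤ 0 := Finset.sum_nonpos fun j _ =>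
            mul_nonpos_of_nonneg_of_nonpos (H.α_nonneg x i j)
              (by have := hxs j; rw [heq]; linarith)
          have h2 := mul_nonneg (H.b_nonneg x i) hpos.le
          linarith
        have hd := (H.deriv i x ⟨ht₀.trans hx.1, hx.2⟩).Ioi_of_Ici
        filter_upwards [hd.limsup_slope_le' self_notMem_Ioi hneg, self_mem_nhdsWithin]
          with z hz hxz
        rw [slope_def_field, div_lt_iff₀ (sub_pos.2 hxz)] at hz
        linarith
    have hall := (Filter.eventually_all.2 hev).and (Ioc_mem_nhdsGT hy)
    exact hall.exists

theorem le_of_initial_le (H : ConsensusInequality S aHi α b h h') {t₀ M : ℝ} (ht₀ : 0 ≤ t₀)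
    (hM : 0 ≤ M) (h₀ : ∀ i, h i t₀ ≤ M) {t : ℝ} (ht : t ∈ Icc t₀ S) (i : ι) : h i t ≤ M := by
  refine le_of_forall_pos_le_add fun ε hε => ?_
  have hpos : 0 < 1 + (t - t₀) := by linarith [ht.1]
  have := H.le_add_mul ht₀ hM (div_pos hε hpos) h₀ ht i
  rwa [div_mul_cancel₀ _ hpos.ne'] at this

theorem deriv_le (H : ConsensusInequality S aHi α b h h') {M t : ℝ} (ht : t ∈ Ico 0 S)
    (hM : ∀ j, h j t ≤ M) (i : ι) :
    h' i t ≤ Fintype.card ι * aHi * (M - h i t) - b t i * h i t := by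
  have : ∑ j, α t i j * (h j t - h i t) ≤ ∑ _j : ι, aHi * (M - h i t) :=
    Finset.sum_le_sum fun j _ => by
      nlinarith [H.α_nonneg t i j, H.α_le t i j, hM j, hM i]
  rw [Finset.sum_const, Finset.card_univ, nsmul_eq_mul] at this
  linarith [H.le i t ht]

theorem deriv_le_of_arc (H : ConsensusInequality S aHi α b h h') {M t aLo : ℝ}
    (ht : t ∈ Ico 0 S) (hM : ∀ j, h j t ≤ M) (i j : ι) (ha : aLo ≤ α t i j) :
    h' i t ≤ Fintype.card ι * aHi * (M - h i t) - aLo * (M - h j t) - b t i * h i t := by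
  classical
  have : ∑ l, α t i l * (h l t - h i t) ≤
      ∑ l : ι, (aHi * (M - h i t) - if l = j then aLo * (M - h j t) else 0) :=
    Finset.sum_le_sum fun l _ => by
      split_ifs with hl
      · subst hl
        nlinarith [H.α_nonneg t i l, H.α_le t i l, hM l, hM i]
      · nlinarith [H.α_nonneg t i l, H.α_le t i l, hM l, hM i]
  rw [Finset.sum_sub_distrib, Finset.sum_const, Finset.card_univ, nsmul_eq_mul,
    Finset.sum_ite_eq' Finset.univ j] at this
  simp only [Finset.mem_univ, if_true] at this
  linarith [H.le i t ht]

/-- A deficit below the upper bound `M` decays at most exponentially. -/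
theorem deficit_hold (H : ConsensusInequality S aHi α b h h') {t₁ t M K δ : ℝ} (ht₁ : 0 ≤ t₁)
    (hM : ∀ s ∈ Icc t₁ S, ∀ j, h j s ≤ M) (hK : Fintype.card ι * aHi < K) (hK₀ : 0 ≤ K)
    (hδ : 0 < δ) (hδM : δ ≤ M) (i : ι) (hi : δ ≤ M - h i t₁) (ht : t ∈ Icc t₁ S) :
    δ * Real.exp (-K * (t - t₁)) ≤ M - h i t := by
  have hB : ∀ s, HasDerivAt (fun s => M - δ * Real.exp (-K * (s - t₁)))
      (K * (δ * Real.exp (-K * (s - t₁)))) s := by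
    intro s
    have h1 : HasDerivAt (fun s => -K * (s - t₁)) (-K * 1) s :=
      ((hasDerivAt_id s).sub_const t₁).const_mul (-K)
    exact ((h1.exp.const_mul δ).const_sub M).congr_deriv (by ring)
  have := image_le_of_deriv_right_lt_deriv_boundary' (f := h i) (f' := h' i)
    (B := fun s => M - δ * Real.exp (-K * (s - t₁))) (a := t₁) (b := S)
    (H.cont i).continuousOn (fun x hx => H.deriv i x ⟨ht₁.trans hx.1, hx.2⟩)
    (by simp only [sub_self, mul_zero, Real.exp_zero, mul_one]; linarith)
    (fun x _ => (hB x).continuousAt.continuousWithinAt)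
    (fun x _ => (hB x).hasDerivWithinAt) ?_ ht
  · linarith
  · intro x hx heq
    have hle : Real.exp (-K * (x - t₁)) ≤ 1 := by
      rw [Real.exp_le_one_iff]
      nlinarith [hx.1]
    have hpos := mul_pos hδ (Real.exp_pos (-K * (x - t₁)))
    set e := δ * Real.exp (-K * (x - t₁)) with he
    have heM : e ≤ M := by
      have := mul_le_of_le_one_right hδ.le hle
      linarith
    have h1 := H.deriv_le ⟨ht₁.trans hx.1, hx.2⟩ (hM x ⟨hx.1, hx.2.le⟩) i
    have h2 := mul_nonneg (H.b_nonneg x i) (show 0 ≤ h i x by linarith)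
    have h3 : M - h i x = e := by linarith
    rw [h3] at h1
    nlinarith

/-- A deficit is transferred along an arc that persists for a time `θ`. -/
theorem deficit_transfer (H : ConsensusInequality S aHi α b h h') {p θ M K κ c δ : ℝ}
    (hp : 0 ≤ p) (hθ : 0 < θ) (hpS : p + θ ≤ S) (hK₀ : 0 ≤ K) (hκ : c < κ)
    (hc : 0 ≤ c) (hcθ : c * θ ≤ 1) (hδ : 0 < δ) (hδM : δ ≤ M) (i : ι) (hi : h i p ≤ M)
    (hd : ∀ s ∈ Ico p (p + θ), 0 ≤ h i s → h i s ≤ M →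
      h' i s ≤ K * (M - h i s) - κ * (δ * Real.exp (-K * (s - p)))) :
    c * θ * (δ * Real.exp (-K * θ)) ≤ M - h i (p + θ) := by
  have hB : ∀ s, HasDerivAt (fun s => M - c * δ * ((s - p) * Real.exp (-K * (s - p))))
      (K * (c * (s - p) * (δ * Real.exp (-K * (s - p)))) -
        c * (δ * Real.exp (-K * (s - p)))) s := by
    intro s
    have h0 : HasDerivAt (fun s => s - p) 1 s := (hasDerivAt_id s).sub_const p
    have h1 : HasDerivAt (fun s => -K * (s - p)) (-K * 1) s := h0.const_mul (-K)
    exact (((h0.mul h1.exp).const_mul (c * δ)).const_sub M).congr_deriv (by ring)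
  have := image_le_of_deriv_right_lt_deriv_boundary' (f := h i) (f' := h' i)
    (B := fun s => M - c * δ * ((s - p) * Real.exp (-K * (s - p)))) (a := p) (b := p + θ)
    (H.cont i).continuousOn
    (fun x hx => H.deriv i x ⟨hp.trans hx.1, hx.2.trans_le hpS⟩)
    (by simpa using hi)
    (fun x _ => (hB x).continuousAt.continuousWithinAt)
    (fun x _ => (hB x).hasDerivWithinAt) ?_ (right_mem_Icc.2 (by linarith))
  · simp only [add_sub_cancel_left] at this
    linarith
  · intro x hx heq
    have hx0 : 0 ≤ x - p := by linarith [hx.1]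
    have hle : Real.exp (-K * (x - p)) ≤ 1 := by
      rw [Real.exp_le_one_iff]
      nlinarith
    have hpos := mul_pos hδ (Real.exp_pos (-K * (x - p)))
    have heM : δ * Real.exp (-K * (x - p)) ≤ M :=
      (mul_le_of_le_one_right hδ.le hle).trans hδM
    have h1 := hd x hx
    set e := δ * Real.exp (-K * (x - p)) with he
    have hcx : c * (x - p) ≤ 1 :=
      (mul_le_mul_of_nonneg_left (by linarith [hx.2]) hc).trans hcθ
    have heq' : M - h i x = c * (x - p) * e := by rw [heq, he]; ring
    have hnn : 0 ≤ c * (x - p) * e := by positivity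
    have hle' : c * (x - p) * e ≤ e := mul_le_of_le_one_left hpos.le hcx
    have h2 := h1 (by linarith) (by linarith)
    rw [heq'] at h2
    nlinarith

/-- Over one window the set of indices with a definite deficit grows. -/
theorem deficit_spread (H : ConsensusInequality S aHi α b h h') {θ T aLo bLo t M K c δ : ℝ}
    (hE : PersistentlyEntering θ T aLo bLo α b) (hθ : 0 < θ) (ht : 0 ≤ t)
    (htS : t + T ≤ S) (hT : 0 ≤ T) (hK : Fintype.card ι * aHi + bLo < K) (hK₀ : 0 ≤ K)
    (hbLo : 0 < bLo) (hca : c < aLo) (hcb : c < bLo)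
    (hc : 0 < c) (hcθ : c * θ ≤ 1) (hδ : 0 < δ) (hδM : δ ≤ M) (hM : ∀ i, h i t ≤ M)
    (A : Finset ι) (hA : ∀ i ∈ A, δ ≤ M - h i t) :
    ∃ A' : Finset ι, (∀ i ∈ A', c * θ * Real.exp (-K * T) * δ ≤ M - h i (t + T)) ∧
      (A' = Finset.univ ∨ A.card + 1 ≤ A'.card) := by
  classical
  have hM' : ∀ s ∈ Icc t S, ∀ j, h j s ≤ M := fun s hs j =>
    H.le_of_initial_le ht (hδ.le.trans hδM) hM hs j
  have hhold : ∀ i ∈ A, ∀ s ∈ Icc t S, δ * Real.exp (-K * (s - t)) ≤ M - h i s := fun i hi s hs =>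
    H.deficit_hold ht hM' (by linarith) hK₀ hδ hδM i (hA i hi) hs
  have hAend : ∀ i ∈ A, c * θ * Real.exp (-K * T) * δ ≤ M - h i (t + T) := by
    intro i hi
    have := hhold i hi (t + T) ⟨by linarith, htS⟩
    rw [add_sub_cancel_left] at this
    refine le_trans ?_ this
    have hpos := mul_pos hδ (Real.exp_pos (-K * T))
    nlinarith
  by_cases hAu : A = Finset.univ
  · exact ⟨A, hAend, Or.inl hAu⟩
  obtain ⟨i, hiA, p, htp, hpT, harc⟩ := hE t ht A hAu
  refine ⟨insert i A, ?_, Or.inr (Finset.card_insert_of_notMem hiA).ge⟩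
  have hp : 0 ≤ p := ht.trans htp
  have hK1 : Fintype.card ι * aHi < K := by linarith
  set δ' := δ * Real.exp (-K * (p - t)) with hδ'
  have hδ'pos : 0 < δ' := by positivity
  have hexp : ∀ s, t ≤ s → Real.exp (-K * (s - t)) ≤ 1 := fun s hs => by
    rw [Real.exp_le_one_iff]
    nlinarith
  have hδ'M : δ' ≤ M := (mul_le_of_le_one_right hδ.le (hexp p htp)).trans hδM
  have hδs : ∀ s, δ' * Real.exp (-K * (s - p)) = δ * Real.exp (-K * (s - t)) := fun s => by
    rw [hδ', mul_assoc, ← Real.exp_add]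
    ring_nf
  have htrans : c * θ * (δ' * Real.exp (-K * θ)) ≤ M - h i (p + θ) := by
    rcases harc with hb | ⟨j, hj, ha⟩
    · refine H.deficit_transfer hp hθ (by linarith) hK₀ hcb hc.le hcθ hδ'pos hδ'M i
        (hM' p ⟨htp, by linarith⟩ i) fun s hs h0 hsM => ?_
      have hts : t ≤ s := htp.trans hs.1
      have h1 := H.deriv_le (t := s) ⟨ht.trans hts, by linarith [hs.2]⟩
        (hM' s ⟨hts, by linarith [hs.2]⟩) i
      have h2 := mul_le_mul_of_nonneg_right (hb s hs) h0
      have h3 : δ' * Real.exp (-K * (s - p)) ≤ M := by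
        rw [hδs]
        exact (mul_le_of_le_one_right hδ.le (hexp s hts)).trans hδM
      have h4 := mul_le_mul_of_nonneg_left h3 hbLo.le
      have h5 := mul_le_mul_of_nonneg_right hK.le (show 0 ≤ M - h i s by linarith)
      linarith
    · refine H.deficit_transfer hp hθ (by linarith) hK₀ hca hc.le hcθ hδ'pos hδ'M i
        (hM' p ⟨htp, by linarith⟩ i) fun s hs h0 hsM => ?_
      have hts : t ≤ s := htp.trans hs.1
      have h1 := H.deriv_le_of_arc (t := s) ⟨ht.trans hts, by linarith [hs.2]⟩
        (hM' s ⟨hts, by linarith [hs.2]⟩) i j (ha s hs)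
      have h2 := mul_nonneg (H.b_nonneg s i) h0
      have h3 := hhold j hj s ⟨hts, by linarith [hs.2]⟩
      rw [← hδs] at h3
      have h4 := mul_le_mul_of_nonneg_left h3 (hc.trans hca).le
      have h5 := mul_le_mul_of_nonneg_right hK1.le (show 0 ≤ M - h i s by linarith)
      linarith
  have hfin : c * θ * Real.exp (-K * T) * δ ≤ M - h i (t + T) := by
    have hle : c * θ * (δ' * Real.exp (-K * θ)) ≤ M := by
      have h1 : δ' * Real.exp (-K * θ) ≤ δ' :=
        mul_le_of_le_one_right hδ'pos.le (by rw [Real.exp_le_one_iff]; nlinarith)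
      have h2 : 0 < δ' * Real.exp (-K * θ) := by positivity
      have h3 := mul_le_of_le_one_left h2.le hcθ
      linarith
    have := H.deficit_hold (t₁ := p + θ) (t := t + T) (by linarith)
      (fun s hs => hM' s ⟨by linarith [hs.1], hs.2⟩) hK1 hK₀ (by positivity) hle i htrans
      ⟨by linarith, htS⟩
    refine le_of_eq_of_le ?_ this
    rw [hδ']
    have : Real.exp (-K * T) = Real.exp (-K * (p - t)) * Real.exp (-K * θ) *
        Real.exp (-K * (t + T - (p + θ))) := by
      rw [← Real.exp_add, ← Real.exp_add]
      ring_nf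
    rw [this]
    ring
  intro l hl
  rcases Finset.mem_insert.1 hl with rfl | hl
  · exact hfin
  · exact hAend l hl

end ConsensusInequality

/-- Uniform contraction of consensus inequalities over a fixed number of windows. -/
theorem exists_contraction_factor (ι : Type*) [Fintype ι] {θ T aLo aHi bLo : ℝ} (hθ : 0 < θ)
    (hT : 0 < T) (haLo : 0 < aLo) (haHi : 0 ≤ aHi) (hbLo : 0 < bLo) :
    ∃ q : ℝ, 0 < q ∧ q < 1 ∧ ∀ (α : ℝ → ι → ι → ℝ) (b : ℝ → ι → ℝ) (h h' : ι → ℝ → ℝ) (S : ℝ),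
      ConsensusInequality S aHi α b h h' → PersistentlyEntering θ T aLo bLo α b →
      ∀ t M : ℝ, 0 ≤ t → t + Fintype.card ι * T ≤ S → 0 ≤ M → (∀ i, h i t ≤ M) →
        ∀ i, h i (t + Fintype.card ι * T) ≤ q * M := by
  set K := Fintype.card ι * aHi + bLo + 1 with hK
  have hK₀ : 0 ≤ K := by positivity
  obtain ⟨c, hc, hcm⟩ : ∃ c, 0 < c ∧ c < min (min aLo bLo) θ⁻¹ :=
    exists_between (by positivity)
  have hcab := hcm.trans_le (min_le_left _ _)
  have hca := hcab.trans_le (min_le_left _ _)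
  have hcb := hcab.trans_le (min_le_right _ _)
  have hcθ : c * θ ≤ 1 := by
    have := hcm.trans_le (min_le_right _ _)
    rw [← inv_mul_cancel₀ hθ.ne']
    exact mul_le_mul_of_nonneg_right this.le hθ.le
  set ρ := c * θ * Real.exp (-K * T) with hρ
  have hρ0 : 0 < ρ := by positivity
  have hρ1 : ρ ≤ 1 := mul_le_one₀ hcθ (Real.exp_pos _).le
    (by rw [Real.exp_le_one_iff]; nlinarith)
  refine ⟨max (1 / 2) (1 - ρ ^ Fintype.card ι), by positivity,
    max_lt (by norm_num) (by linarith [pow_pos hρ0 (Fintype.card ι)]), ?_⟩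
  intro α b h h' S H hE t M ht htS hM hi i
  have hTl : ∀ l : ℕ, l ≤ Fintype.card ι → t + l * T ≤ S := fun l hl => by
    have : (l : ℝ) ≤ Fintype.card ι := by exact_mod_cast hl
    nlinarith
  have ht' : ∀ l : ℕ, t ≤ t + l * T := fun l => by
    have : 0 ≤ l * T := by positivity
    linarith
  rcases hM.eq_or_lt with rfl | hMpos
  · simpa using H.le_of_initial_le ht hM hi ⟨ht' _, htS⟩ i
  have key : ∀ l : ℕ, l ≤ Fintype.card ι → ∃ A : Finset ι,
      (∀ i ∈ A, ρ ^ l * M ≤ M - h i (t + l * T)) ∧ (A = Finset.univ ∨ l ≤ A.card) := by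
    intro l
    induction l with
    | zero => exact fun _ => ⟨∅, by simp⟩
    | succ l ih =>
      intro hl
      obtain ⟨A, hA, hcard⟩ := ih (by omega)
      have hl1 := hTl (l + 1) hl
      have heq : t + ((l + 1 : ℕ) : ℝ) * T = t + l * T + T := by push_cast; ring
      rw [heq] at hl1 ⊢
      obtain ⟨A', hA', hcard'⟩ := H.deficit_spread (K := K) hE hθ (ht.trans (ht' l)) hl1 hT.le
        (by linarith) hK₀ hbLo hca hcb hc hcθ (show 0 < ρ ^ l * M by positivity)
        (mul_le_of_le_one_left hM (pow_le_one₀ hρ0.le hρ1))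
        (fun i => H.le_of_initial_le ht hM hi ⟨ht' l, by linarith⟩ i) A hA
      refine ⟨A', fun i hi => ?_, ?_⟩
      · rw [pow_succ', mul_assoc]
        exact hA' i hi
      · rcases hcard' with h1 | h1
        · exact Or.inl h1
        · rcases hcard with h2 | h2
          · have := A'.card_le_univ
            rw [h2, Finset.card_univ] at h1
            omega
          · exact Or.inr (by omega)
  obtain ⟨A, hA, hcard⟩ := key _ le_rfl
  have hAu : A = Finset.univ := hcard.elim id fun h1 =>
    Finset.eq_univ_of_card A (le_antisymm A.card_le_univ h1)
  have h1 := hA i (hAu ▸ Finset.mem_univ i)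
  have h2 := mul_le_mul_of_nonneg_right
    (le_max_right (1 / 2) (1 - ρ ^ Fintype.card ι)) hM
  linarith

/-- Uniform decay of consensus inequalities. -/
theorem exists_decay_rate (ι : Type*) [Fintype ι] [Nonempty ι] {θ T aLo aHi bLo : ℝ}
    (hθ : 0 < θ) (hT : 0 < T) (haLo : 0 < aLo) (haHi : 0 ≤ aHi) (hbLo : 0 < bLo) :
    ∃ q P : ℝ, 0 < q ∧ q < 1 ∧ 0 < P ∧
      ∀ (α : ℝ → ι → ι → ℝ) (b : ℝ → ι → ℝ) (h h' : ι → ℝ → ℝ) (S : ℝ),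
      ConsensusInequality S aHi α b h h' → PersistentlyEntering θ T aLo bLo α b →
      ∀ M : ℝ, 0 ≤ S → 0 ≤ M → (∀ i, h i 0 ≤ M) → ∀ i, h i S ≤ q ^ ⌊S / P⌋₊ * M := by
  obtain ⟨q, hq0, hq1, hq⟩ := exists_contraction_factor ι hθ hT haLo haHi hbLo
  have hP : 0 < Fintype.card ι * T := by
    have : 0 < Fintype.card ι := Fintype.card_pos
    positivity
  refine ⟨q, Fintype.card ι * T, hq0, hq1, hP, ?_⟩
  intro α b h h' S H hE M hS hM h0 i
  set P := Fintype.card ι * T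
  have key : ∀ m : ℕ, m * P ≤ S → ∀ i, h i (m * P) ≤ q ^ m * M := by
    intro m
    induction m with
    | zero => exact fun _ => by simpa using h0
    | succ m ih =>
      intro hm i
      have heq : ((m + 1 : ℕ) : ℝ) * P = m * P + P := by push_cast; ring
      rw [heq] at hm ⊢
      rw [pow_succ', mul_assoc]
      exact hq α b h h' S H hE _ _ (by positivity) hm (by positivity) (ih (by linarith)) i
  have hle : (⌊S / P⌋₊ : ℝ) * P ≤ S := by
    have := Nat.floor_le (show 0 ≤ S / P by positivity)
    rwa [le_div_iff₀ hP] at this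
  exact H.le_of_initial_le (by positivity) (by positivity) (key _ hle) ⟨hle, le_rfl⟩ i

theorem exists_norm_le_one_infDist_le_inner {E : Type*} [NormedAddCommGroup E]
    [InnerProductSpace ℝ E] {L : Set E} (hL : IsCompact L) (hc : Convex ℝ L) (hne : L.Nonempty)
    (x : E) : ∃ p : E, ‖p‖ ≤ 1 ∧ ∀ y ∈ L, infDist x L ≤ inner ℝ p (x - y) := by
  obtain ⟨y₀, hy₀, hdist⟩ := exists_norm_eq_iInf_of_complete_convex hne hL.isComplete hc x
  have hproj := (norm_eq_iInf_iff_real_inner_le_zero hc hy₀).1 hdist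
  have hinf : infDist x L ≤ ‖x - y₀‖ := by
    rw [← dist_eq_norm]
    exact infDist_le_dist_of_mem hy₀
  refine ⟨‖x - y₀‖⁻¹ • (x - y₀), ?_, fun y hy => hinf.trans ?_⟩
  · rw [norm_smul, norm_inv, norm_norm]
    exact inv_mul_le_one
  · have h1 : x - y = (x - y₀) - (y - y₀) := by abel
    rw [h1, inner_sub_right, real_inner_smul_left, real_inner_smul_left,
      real_inner_self_eq_norm_sq]
    have h2 : ‖x - y₀‖⁻¹ * inner ℝ (x - y₀) (y - y₀) ≤ 0 :=
      mul_nonpos_of_nonneg_of_nonpos (by positivity) (hproj y hy)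
    have h3 : ‖x - y₀‖⁻¹ * ‖x - y₀‖ ^ 2 = ‖x - y₀‖ := by
      rcases eq_or_ne ‖x - y₀‖ 0 with h | h
      · simp [h]
      · field_simp
    linarith

theorem inner_sub_le_infDist_convexHull {E : Type*} [NormedAddCommGroup E]
    [InnerProductSpace ℝ E] {s : Set E} (hne : s.Nonempty) {p : E} (hp : ‖p‖ ≤ 1) {G : ℝ}
    (hG : ∀ y ∈ s, inner ℝ p y ≤ G) (x : E) :
    inner ℝ p x - G ≤ infDist x (convexHull ℝ s) := by
  rw [le_infDist (convexHull_nonempty_iff.2 hne)]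
  intro y hy
  have hsub : convexHull ℝ s ⊆ {y | inner ℝ p y ≤ G} :=
    convexHull_min hG (convex_halfSpace_le (innerₛₗ ℝ p).isLinear G)
  have h1 : inner ℝ p y ≤ G := hsub hy
  have h2 := real_inner_le_norm p (x - y)
  rw [inner_sub_right] at h2
  have h3 := mul_le_of_le_one_left (norm_nonneg (x - y)) hp
  rw [dist_eq_norm]
  linarith

theorem Relation.ReflTransGen.exists_crossing {V : Type*} {r : V → V → Prop} {P : V → Prop}
    {a b : V} (h : Relation.ReflTransGen r a b) (ha : P a) (hb : ¬P b) :
    ∃ u v, r u v ∧ P u ∧ ¬P v := by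
  induction h with
  | refl => exact absurd ha hb
  | @tail u v _ huv ih =>
    by_cases hu : P u
    · exact ⟨u, v, huv, hu, hb⟩
    · exact ih hu

namespace MASData

variable {d n k : ℕ} (D : MASData d n k)

theorem aHi_nonneg : 0 ≤ D.aHi := by
  have i : Fin n := ⟨0, by have := D.hn; omega⟩
  have := D.A_bdd i i 0 0 0
  linarith [D.aLo_pos]

/-- Around every time there is an interval of length `τD / 2` on which the topology is constant. -/
theorem exists_constant_topology {s : ℝ} (hs : 0 ≤ s) :
    ∃ p, s - D.τD / 2 ≤ p ∧ p ≤ s ∧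
      ∀ t ∈ Ico p (p + D.τD / 2), D.Nb t = D.Nb s ∧ D.Ld t = D.Ld s := by
  have hτ := D.τD_pos
  obtain ⟨σ, hσ0, hσ, hconst⟩ := D.dwell
  have hgrow : ∀ m : ℕ, m * D.τD ≤ σ m := by
    intro m
    induction m with
    | zero => simp [hσ0]
    | succ m ih =>
      push_cast
      linarith [hσ m]
  have hex : ∃ m, s < σ (m + 1) := by
    obtain ⟨m, hm⟩ := exists_nat_gt (s / D.τD)
    rw [div_lt_iff₀ hτ] at hm
    exact ⟨m, by linarith [hσ m, hgrow m]⟩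
  classical
  set m := Nat.find hex
  have hm : s < σ (m + 1) := Nat.find_spec hex
  have hm' : σ m ≤ s := by
    rcases Nat.eq_zero_or_pos m with h | h
    · rw [h, hσ0]
      exact hs
    · have := Nat.find_min hex (Nat.sub_one_lt_of_lt h)
      rw [Nat.sub_add_cancel h] at this
      exact not_lt.1 this
  rcases le_total (s + D.τD / 2) (σ (m + 1)) with h | h
  · exact ⟨s, by linarith, le_rfl, fun t ht =>
      hconst m t ⟨by linarith [ht.1], by linarith [ht.2]⟩ s ⟨hm', hm⟩⟩
  · exact ⟨s - D.τD / 2, le_rfl, by linarith, fun t ht =>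
      hconst m t ⟨by linarith [ht.1, hσ m], by linarith [ht.2]⟩ s ⟨hm', hm⟩⟩

/-- In every window of length `T + τD`, a proper set of followers is entered by an arc that
persists for half the dwell time. -/
theorem exists_persistent_arc {T : ℝ} (hU : ∀ t ≥ (0 : ℝ), D.LConnectedOn (Ico t (t + T)))
    {t : ℝ} (ht : 0 ≤ t) {A : Finset (Fin n)} (hA : A ≠ Finset.univ) :
    ∃ i ∉ A, ∃ p, t ≤ p ∧ p + D.τD / 2 ≤ t + (T + D.τD) ∧
      ((∃ j, ∀ s ∈ Ico p (p + D.τD / 2), j ∈ D.Ld s i) ∨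
        ∃ j ∈ A, ∀ s ∈ Ico p (p + D.τD / 2), j ∈ D.Nb s i) := by
  have hτ := D.τD_pos
  obtain ⟨i, hi⟩ : ∃ i, i ∉ A := by
    by_contra! h
    exact hA (Finset.eq_univ_of_forall h)
  obtain ⟨l, hl⟩ := hU (t + D.τD / 2) (by positivity) i
  obtain ⟨v, v', ⟨s, hs, harc⟩, hv, hv'⟩ :=
    hl.exists_crossing (P := fun v => ∀ i, v = Sum.inr i → i ∈ A) (by simp)
      (fun h => hi (h i rfl))
  obtain ⟨p, hp1, hp2, hconst⟩ := D.exists_constant_topology (s := s) (by linarith [hs.1])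
  push Not at hv'
  obtain ⟨i', rfl, hi'⟩ := hv'
  refine ⟨i', hi', p, by linarith [hs.1], by linarith [hs.2], ?_⟩
  rcases v with j | j
  · exact Or.inl ⟨j, fun r hr => by rw [(hconst r hr).2]; exact harc⟩
  · exact Or.inr ⟨j, hv j rfl, fun r hr => by rw [(hconst r hr).1]; exact harc⟩

end MASData

namespace MASSol

variable {d n k : ℕ} {D : MASData d n k} (sol : MASSol D)

theorem norm_u_le_znorm (j : Fin k) (t : ℝ) : ‖sol.u j (sol.y t) t‖ ≤ sol.znorm t := by
  refine Real.le_sqrt_of_sq_le ?_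
  have h1 := Finset.single_le_sum (f := fun j => ‖sol.u j (sol.y t) t‖ ^ 2)
    (fun _ _ => by positivity) (Finset.mem_univ j)
  have h2 : 0 ≤ ∑ i, ‖sol.w i t‖ ^ 2 := by positivity
  linarith

theorem norm_w_le_znorm (i : Fin n) (t : ℝ) : ‖sol.w i t‖ ≤ sol.znorm t := by
  refine Real.le_sqrt_of_sq_le ?_
  have h1 := Finset.single_le_sum (f := fun i => ‖sol.w i t‖ ^ 2)
    (fun _ _ => by positivity) (Finset.mem_univ i)
  have h2 : 0 ≤ ∑ j, ‖sol.u j (sol.y t) t‖ ^ 2 := by positivity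
  linarith

theorem znorm_nonneg (t : ℝ) : 0 ≤ sol.znorm t := Real.sqrt_nonneg _

theorem intervalIntegrable_znorm (a b : ℝ) : IntervalIntegrable sol.znorm volume a b :=
  sol.z_int a b

theorem infDist_le_distL (i : Fin n) (t : ℝ) : infDist (sol.x t i) (sol.Lset t) ≤ sol.distL t :=
  le_ciSup (f := fun i => infDist (sol.x t i) (sol.Lset t)) (Finite.bddAbove_range _) i

theorem distL_nonneg (t : ℝ) : 0 ≤ sol.distL t := Real.iSup_nonneg fun _ => infDist_nonneg

theorem inner_y_sub_le {p : EuclideanSpace ℝ (Fin d)} (hp : ‖p‖ ≤ 1) (j : Fin k) {t : ℝ}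
    (ht : 0 ≤ t) :
    inner ℝ p (sol.y t j) - inner ℝ p (sol.y 0 j) ≤ ∫ s in (0 : ℝ)..t, sol.znorm s := by
  have hint : IntegrableOn sol.znorm (Icc 0 t) volume := by
    rw [integrableOn_Icc_iff_integrableOn_Ioc]
    exact (intervalIntegrable_iff_integrableOn_Ioc_of_le ht).1 (sol.intervalIntegrable_znorm 0 t)
  refine intervalIntegral.sub_le_integral_of_hasDeriv_right_of_le
    (g := fun s => inner ℝ p (sol.y s j)) (g' := fun s => inner ℝ p (sol.u j (sol.y s) s)) ht
    (continuous_const.inner (sol.y_cont j)).continuousOn (fun s hs => ?_) hint fun s _ => ?_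
  · have := (hasDerivWithinAt_const s (Ici s) p).inner ℝ (sol.dyn_y j s hs.1.le)
    simpa using this.Ioi_of_Ici
  · refine (real_inner_le_norm _ _).trans ?_
    exact (mul_le_of_le_one_left (norm_nonneg _) hp).trans (sol.norm_u_le_znorm j s)

/-- The projection of the system on a direction `p`, corrected by the inputs, satisfies a consensus
inequality. -/
theorem consensusInequality {p : EuclideanSpace ℝ (Fin d)} (hp : ‖p‖ ≤ 1) {S G : ℝ}
    (hG : ∀ j, ∀ t ∈ Ico 0 S, inner ℝ p (sol.y t j) ≤ G) :
    ConsensusInequality S D.aHi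
      (fun t i j => if j ∈ D.Nb t i then D.A i j (sol.x t) (sol.y t) t else 0)
      (fun t i => ∑ j ∈ D.Ld t i, D.B i j (sol.x t) (sol.y t) t)
      (fun i t => inner ℝ p (sol.x t i) - G - ∫ s in (0 : ℝ)..t, ∑ l, ‖sol.w l s‖)
      (fun i t => inner ℝ p ((∑ j ∈ D.Nb t i, D.A i j (sol.x t) (sol.y t) t •
          (sol.x t j - sol.x t i)) + (∑ j ∈ D.Ld t i, D.B i j (sol.x t) (sol.y t) t •
          (sol.y t j - sol.x t i)) + sol.w i t) - ∑ l, ‖sol.w l t‖) := by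
  have hw : Continuous fun s => ∑ l, ‖sol.w l s‖ :=
    continuous_finsetSum _ fun l _ => (sol.w_cont l).norm
  have hW : ∀ t, HasDerivAt (fun t => ∫ s in (0 : ℝ)..t, ∑ l, ‖sol.w l s‖)
      (∑ l, ‖sol.w l t‖) t := fun t => (hw.integral_hasStrictDerivAt 0 t).hasDerivAt
  refine ⟨fun i => ?_, fun i t ht => ?_, fun i t ht => ?_, fun t i j => ?_, fun t i j => ?_,
    fun t i => Finset.sum_nonneg fun j _ => D.bLo_pos.le.trans (D.B_bdd i j _ _ _)⟩
  · have hWc : Continuous fun t => ∫ s in (0 : ℝ)..t, ∑ l, ‖sol.w l s‖ :=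
      continuous_iff_continuousAt.2 fun t => (hW t).continuousAt
    exact ((continuous_const.inner (sol.x_cont i)).sub continuous_const).sub hWc
  · have h1 := (hasDerivWithinAt_const t (Ici t) p).inner ℝ (sol.dyn_x i t ht.1)
    rw [inner_zero_left, add_zero] at h1
    exact (h1.sub_const G).sub (hW t).hasDerivWithinAt
  · have hWt : 0 ≤ ∫ s in (0 : ℝ)..t, ∑ l, ‖sol.w l s‖ :=
      intervalIntegral.integral_nonneg ht.1 fun _ _ => by positivity
    have hwi : inner ℝ p (sol.w i t) ≤ ∑ l, ‖sol.w l t‖ :=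
      ((real_inner_le_norm _ _).trans (mul_le_of_le_one_left (norm_nonneg _) hp)).trans
        (Finset.single_le_sum (f := fun l => ‖sol.w l t‖) (fun _ _ => norm_nonneg _)
          (Finset.mem_univ i))
    simp only [inner_add_right, inner_sum, real_inner_smul_right, inner_sub_right, ite_mul,
      zero_mul, Finset.sum_ite_mem, Finset.univ_inter, sub_sub_sub_cancel_right]
    have hB : ∑ j ∈ D.Ld t i, D.B i j (sol.x t) (sol.y t) t *
        (inner ℝ p (sol.y t j) - inner ℝ p (sol.x t i)) ≤
        -((∑ j ∈ D.Ld t i, D.B i j (sol.x t) (sol.y t) t) *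
          (inner ℝ p (sol.x t i) - G - ∫ s in (0 : ℝ)..t, ∑ l, ‖sol.w l s‖)) := by
      rw [← mul_neg, Finset.sum_mul]
      refine Finset.sum_le_sum fun j _ => mul_le_mul_of_nonneg_left ?_
        (D.bLo_pos.le.trans (D.B_bdd i j _ _ _))
      linarith [hG j t ht]
    linarith
  · split_ifs
    exacts [D.aLo_pos.le.trans (D.A_bdd i j _ _ _).1, le_rfl]
  · split_ifs
    exacts [(D.A_bdd i j _ _ _).2, D.aHi_nonneg]

theorem persistentlyEntering {T : ℝ} (hU : ∀ t ≥ (0 : ℝ), D.LConnectedOn (Ico t (t + T))) :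
    PersistentlyEntering (D.τD / 2) (T + D.τD) D.aLo D.bLo
      (fun t i j => if j ∈ D.Nb t i then D.A i j (sol.x t) (sol.y t) t else 0)
      (fun t i => ∑ j ∈ D.Ld t i, D.B i j (sol.x t) (sol.y t) t) := by
  intro t ht A hA
  obtain ⟨i, hi, p, hp1, hp2, harc⟩ := D.exists_persistent_arc hU ht hA
  refine ⟨i, hi, p, hp1, hp2, ?_⟩
  rcases harc with ⟨j, hj⟩ | ⟨j, hj, hjs⟩
  · refine Or.inl fun s hs => ?_
    exact (D.B_bdd i j _ _ _).trans (Finset.single_le_sum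
      (f := fun j => D.B i j (sol.x s) (sol.y s) s)
      (fun l _ => D.bLo_pos.le.trans (D.B_bdd i l _ _ _)) (hj s hs))
  · refine Or.inr ⟨j, hj, fun s hs => ?_⟩
    simp only [if_pos (hjs s hs)]
    exact (D.A_bdd i j _ _ _).1

end MASSol

open MASSol in
theorem MASData.UJLC.exists_decay_bound {d n k : ℕ} {D : MASData d n k} (hU : D.UJLC) :
    ∃ q P : ℝ, 0 < q ∧ q < 1 ∧ 0 < P ∧ ∀ sol : MASSol D, ∀ t ≥ (0 : ℝ),
      sol.distL t ≤ q ^ ⌊t / P⌋₊ * sol.distL 0 +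
        ∫ s in (0 : ℝ)..t, ((n : ℝ) + 2) * sol.znorm s := by
  obtain ⟨T, hT, hU⟩ := hU
  have : Nonempty (Fin n) := ⟨⟨0, by have := D.hn; omega⟩⟩
  have : Nonempty (Fin k) := ⟨⟨0, D.hk⟩⟩
  have hτ := D.τD_pos
  obtain ⟨q, P, hq0, hq1, hP, hdecay⟩ := exists_decay_rate (Fin n) (half_pos hτ)
    (add_pos hT hτ) D.aLo_pos D.aHi_nonneg D.bLo_pos
  refine ⟨q, P, hq0, hq1, hP, fun sol t ht => ciSup_le fun i => ?_⟩
  obtain ⟨p, hp, hpinf⟩ := exists_norm_le_one_infDist_le_inner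
    ((finite_range (sol.y t)).isCompact_convexHull ℝ) (convex_convexHull ℝ _)
    (convexHull_nonempty_iff.2 (range_nonempty (sol.y t))) (sol.x t i)
  obtain ⟨l, hl⟩ := Finite.exists_max fun j => (inner ℝ p (sol.y 0 j) : ℝ)
  set Z := ∫ s in (0 : ℝ)..t, sol.znorm s with hZ
  set G := inner ℝ p (sol.y 0 l) + Z with hG
  have hZmono : ∀ s ∈ Icc 0 t, ∫ r in (0 : ℝ)..s, sol.znorm r ≤ Z := fun s hs =>
    intervalIntegral.integral_mono_interval le_rfl hs.1 hs.2
      (Eventually.of_forall sol.znorm_nonneg) (sol.intervalIntegrable_znorm 0 t)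
  have hZ0 : 0 ≤ Z := intervalIntegral.integral_nonneg ht fun _ _ => sol.znorm_nonneg _
  have hyG : ∀ j, ∀ s ∈ Ico 0 t, inner ℝ p (sol.y s j) ≤ G := fun j s hs => by
    have h1 := sol.inner_y_sub_le hp j hs.1
    have h2 := hZmono s ⟨hs.1, hs.2.le⟩
    have h3 := hl j
    linarith
  have hfin := hdecay _ _ _ _ t (sol.consensusInequality hp hyG) (sol.persistentlyEntering hU)
    (sol.distL 0) ht (sol.distL_nonneg 0) (fun j => by
      have h1 := inner_sub_le_infDist_convexHull (range_nonempty (sol.y 0)) hp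
        (G := inner ℝ p (sol.y 0 l)) (by rintro _ ⟨j, rfl⟩; exact hl j) (sol.x 0 j)
      have h2 := sol.infDist_le_distL j 0
      rw [Lset] at h2
      rw [intervalIntegral.integral_same]
      linarith) i
  have hw : Continuous fun s => ∑ l, ‖sol.w l s‖ :=
    continuous_finsetSum _ fun l _ => (sol.w_cont l).norm
  have hW : ∫ s in (0 : ℝ)..t, ∑ l, ‖sol.w l s‖ ≤ n * Z := by
    rw [hZ, ← intervalIntegral.integral_const_mul]
    refine intervalIntegral.integral_mono_on ht (hw.intervalIntegrable 0 t)
      ((sol.intervalIntegrable_znorm 0 t).const_mul _) fun s _ => ?_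
    calc ∑ l, ‖sol.w l s‖ ≤ ∑ _l : Fin n, sol.znorm s :=
          Finset.sum_le_sum fun l _ => sol.norm_w_le_znorm l s
      _ = n * sol.znorm s := by simp
  have hyl := sol.inner_y_sub_le (p := -p) (by rwa [norm_neg]) l ht
  have hinf := hpinf (sol.y t l) (subset_convexHull ℝ _ (mem_range_self l))
  rw [inner_sub_right] at hinf
  rw [inner_neg_left, inner_neg_left] at hyl
  rw [intervalIntegral.integral_const_mul]
  change infDist (sol.x t i) (sol.Lset t) ≤ _
  rw [Lset]
  linarith

theorem isClassKL_pow_floor {q P : ℝ} (hq0 : 0 < q) (hq1 : q < 1) (hP : 0 < P) :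
    IsClassKL fun s t => q ^ ⌊t / P⌋₊ * s := by
  refine ⟨fun t _ => ⟨by fun_prop, fun a _ b _ hab =>
    mul_lt_mul_of_pos_left hab (by positivity), mul_zero _⟩, fun s hs => ⟨?_, ?_⟩⟩
  · intro a _ b _ hab
    exact mul_le_mul_of_nonneg_right
      (pow_le_pow_of_le_one hq0.le hq1.le (Nat.floor_mono (by gcongr))) hs
  · have h1 : Tendsto (fun t : ℝ => ⌊t / P⌋₊) atTop atTop :=
      tendsto_nat_floor_atTop.comp (tendsto_id.atTop_div_const hP)
    have h2 := ((tendsto_pow_atTop_nhds_zero_of_lt_one hq0.le hq1).comp h1).mul_const s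
    rwa [zero_mul] at h2

/-- **Theorem 2 (Theorem `thmr1`).**  If the switching interaction graph is
uniformly jointly L-connected, then system (5) is SiISS with respect to
`ℒ(y(t))`; moreover the gain can be taken as `γ(s) = (4n+1)√2·s`. -/
theorem ujlc_implies_SiISS {d n k : ℕ} (D : MASData d n k) (hU : D.UJLC) :
    D.SiISS ∧
    ∃ β : ℝ → ℝ → ℝ, IsClassKL β ∧
      ∀ sol : MASSol D, ∀ t ≥ (0:ℝ),
        sol.distL t ≤ β (sol.distL 0) t +
          ∫ s in (0:ℝ)..t, (4 * (n:ℝ) + 1) * Real.sqrt 2 * sol.znorm s := by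
  obtain ⟨q, P, hq0, hq1, hP, hbound⟩ := hU.exists_decay_bound
  have hmain : ∀ sol : MASSol D, ∀ t ≥ (0:ℝ), sol.distL t ≤ q ^ ⌊t / P⌋₊ * sol.distL 0 +
      ∫ s in (0:ℝ)..t, (4 * (n:ℝ) + 1) * Real.sqrt 2 * sol.znorm s := by
    intro sol t ht
    refine (hbound sol t ht).trans (add_le_add le_rfl ?_)
    refine intervalIntegral.integral_mono_on ht
      ((sol.intervalIntegrable_znorm 0 t).const_mul _)
      ((sol.intervalIntegrable_znorm 0 t).const_mul _) fun s _ =>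
        mul_le_mul_of_nonneg_right ?_ (sol.znorm_nonneg s)
    have h1 : (1 : ℝ) ≤ Real.sqrt 2 := Real.one_le_sqrt.2 (by norm_num)
    have h2 : (2 : ℝ) ≤ n := by exact_mod_cast D.hn
    nlinarith
  have hβ := isClassKL_pow_floor hq0 hq1 hP
  refine ⟨⟨_, fun s => (4 * (n:ℝ) + 1) * Real.sqrt 2 * s, hβ, ⟨by fun_prop, ?_, mul_zero _⟩,
    hmain⟩, _, hβ, hmain⟩
  exact fun a _ b _ hab => mul_lt_mul_of_pos_left hab (by positivity)
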